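/- Let Φ : D → R^3 be a conformal immersion with conformal Gauss map Y, and X = π^{-1}∘Φ, Z = π̃^{-1}∘Φ its representations in S^3 and H^3. Then H = Y_5 − Y_4, h = Y_5 and H^Z = −Y_4, where H, h, H^Z are the mean curvatures of Φ, X, Z respectively. -/

import Mathlib

noncomputable section

/-- The Lorentzian bilinear form on `ℝ^{4,1} = ℝ⁵`. -/
def L5 (u v : Fin 5 → ℝ) : ℝ :=
  u 0 * v 0 + u 1 * v 1 + u 2 * v 2 + u 3 * v 3 - u 4 * v 4

/-- Euclidean dot product on `ℝ³`. -/
def dot3 (u v : Fin 3 → ℝ) : ℝ := u 0 * v 0 + u 1 * v 1 + u 2 * v 2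

/-- `|x|²` on `ℝ³`. -/
def nsq (x : Fin 3 → ℝ) : ℝ := x 0 ^ 2 + x 1 ^ 2 + x 2 ^ 2

/-- The isotropic lift `p(x) = (x, (|x|²-1)/2, (|x|²+1)/2)`. -/
def pmap (x : Fin 3 → ℝ) : Fin 5 → ℝ :=
  ![x 0, x 1, x 2, (nsq x - 1) / 2, (nsq x + 1) / 2]

/-- Partial derivative in the first variable. -/
def d1 {E : Type*} [NormedAddCommGroup E] [NormedSpace ℝ E]
    (f : ℝ × ℝ → E) (w : ℝ × ℝ) : E := fderiv ℝ f w (1, 0)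

/-- Partial derivative in the second variable. -/
def d2 {E : Type*} [NormedAddCommGroup E] [NormedSpace ℝ E]
    (f : ℝ × ℝ → E) (w : ℝ × ℝ) : E := fderiv ℝ f w (0, 1)

/-- Flat Laplacian. -/
def lap {E : Type*} [NormedAddCommGroup E] [NormedSpace ℝ E]
    (f : ℝ × ℝ → E) (w : ℝ × ℝ) : E := d1 (d1 f) w + d2 (d2 f) w

/-- The mean curvature `H = ⟨Φ_zz̄, n⟩/|Φ_z|² = ⟨ΔΦ, n⟩/(2|Φ_x|²)` of a conformal
immersion `Φ` with unit normal `n`. -/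
def meanH (Φ n : ℝ × ℝ → Fin 3 → ℝ) (w : ℝ × ℝ) : ℝ :=
  dot3 (lap Φ w) (n w) / (2 * dot3 (d1 Φ w) (d1 Φ w))

/-- The conformal Gauss map
`Y = H·(Φ, (|Φ|²−1)/2, (|Φ|²+1)/2) + (n, ⟨n,Φ⟩, ⟨n,Φ⟩)`. -/
def confGauss (Φ n : ℝ × ℝ → Fin 3 → ℝ) (w : ℝ × ℝ) : Fin 5 → ℝ :=
  meanH Φ n w • pmap (Φ w) +
    ![n w 0, n w 1, n w 2, dot3 (n w) (Φ w), dot3 (n w) (Φ w)]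

/-- Euclidean dot product on `ℝ⁴`. -/
def dot4 (u v : Fin 4 → ℝ) : ℝ := u 0 * v 0 + u 1 * v 1 + u 2 * v 2 + u 3 * v 3

/-- The Lorentzian product on `ℝ^{3,1}`. -/
def L31 (u v : Fin 4 → ℝ) : ℝ := u 0 * v 0 + u 1 * v 1 + u 2 * v 2 - u 3 * v 3

/-- The representation `X = π⁻¹ ∘ Φ` of `Φ` in `S³`. -/
def repS3 (Φ : ℝ × ℝ → Fin 3 → ℝ) (w : ℝ × ℝ) : Fin 4 → ℝ :=
  (1 / (1 + nsq (Φ w))) •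
    ![2 * Φ w 0, 2 * Φ w 1, 2 * Φ w 2, nsq (Φ w) - 1]

/-- The Gauss map of `X = π⁻¹ ∘ Φ`, induced by the Gauss map `n` of `Φ`
through `dπ⁻¹`: `N = (n,0) − (2⟨n,Φ⟩/(1+|Φ|²))·(Φ,−1)`. -/
def gaussS3 (Φ n : ℝ × ℝ → Fin 3 → ℝ) (w : ℝ × ℝ) : Fin 4 → ℝ :=
  ![n w 0, n w 1, n w 2, 0] -
    (2 * dot3 (n w) (Φ w) / (1 + nsq (Φ w))) • ![Φ w 0, Φ w 1, Φ w 2, -1]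

/-- The mean curvature of `X` in `S³`. -/
def meanS3 (Φ n : ℝ × ℝ → Fin 3 → ℝ) (w : ℝ × ℝ) : ℝ :=
  dot4 (lap (repS3 Φ) w) (gaussS3 Φ n w) /
    (2 * dot4 (d1 (repS3 Φ) w) (d1 (repS3 Φ) w))

/-- The representation `Z = π̃⁻¹ ∘ Φ` of `Φ` in `ℍ³ ⊂ ℝ^{3,1}`. -/
def repH3 (Φ : ℝ × ℝ → Fin 3 → ℝ) (w : ℝ × ℝ) : Fin 4 → ℝ :=
  (1 / (1 - nsq (Φ w))) •
    ![2 * Φ w 0, 2 * Φ w 1, 2 * Φ w 2, nsq (Φ w) + 1]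

/-- The Gauss map of `Z = π̃⁻¹ ∘ Φ`, induced by `n`:
`n^Z = (n,0) + (2⟨n,Φ⟩/(1−|Φ|²))·(Φ,1)`. -/
def gaussH3 (Φ n : ℝ × ℝ → Fin 3 → ℝ) (w : ℝ × ℝ) : Fin 4 → ℝ :=
  ![n w 0, n w 1, n w 2, 0] +
    (2 * dot3 (n w) (Φ w) / (1 - nsq (Φ w))) • ![Φ w 0, Φ w 1, Φ w 2, 1]

/-- The mean curvature of `Z` in `ℍ³`. -/
def meanH3 (Φ n : ℝ × ℝ → Fin 3 → ℝ) (w : ℝ × ℝ) : ℝ :=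
  L31 (lap (repH3 Φ) w) (gaussH3 Φ n w) /
    (2 * L31 (d1 (repH3 Φ) w) (d1 (repH3 Φ) w))

/-- The derivative of `f` in the fixed direction `v`. -/
def dirDeriv (v : ℝ × ℝ) {E : Type*} [NormedAddCommGroup E] [NormedSpace ℝ E]
    (f : ℝ × ℝ → E) (w : ℝ × ℝ) : E := fderiv ℝ f w v

section dirDeriv

variable {v w : ℝ × ℝ}

lemma dirDeriv_mul {f g : ℝ × ℝ → ℝ} (hf : Differentiable ℝ f) (hg : Differentiable ℝ g) :
    dirDeriv v (fun x => f x * g x) w = dirDeriv v f w * g w + f w * dirDeriv v g w := by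
  simp only [dirDeriv]
  rw [fderiv_fun_mul (hf w) (hg w)]
  simp
  ring

lemma dirDeriv_add {f g : ℝ × ℝ → ℝ} (hf : Differentiable ℝ f) (hg : Differentiable ℝ g) :
    dirDeriv v (fun x => f x + g x) w = dirDeriv v f w + dirDeriv v g w := by
  simp only [dirDeriv]
  rw [fderiv_fun_add (hf w) (hg w)]
  simp

lemma dirDeriv_const (c : ℝ) : dirDeriv v (fun _ => c) w = 0 := by
  simp [dirDeriv]

lemma dirDeriv_apply {k : ℕ} {f : ℝ × ℝ → Fin k → ℝ} (hf : Differentiable ℝ f) (j : Fin k) :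
    dirDeriv v f w j = dirDeriv v (fun x => f x j) w := by
  simp only [dirDeriv]
  rw [fderiv_apply (hf w) j]
  simp

lemma contDiff_dirDeriv {E : Type*} [NormedAddCommGroup E] [NormedSpace ℝ E] {f : ℝ × ℝ → E}
    (hf : ContDiff ℝ (⊤ : ℕ∞) f) : ContDiff ℝ (⊤ : ℕ∞) (dirDeriv v f) :=
  (hf.fderiv_right (m := (⊤ : ℕ∞)) (by simp)).clm_apply contDiff_const

lemma ContDiff.differentiable_top {E : Type*} [NormedAddCommGroup E] [NormedSpace ℝ E]
    {f : ℝ × ℝ → E} (hf : ContDiff ℝ (⊤ : ℕ∞) f) : Differentiable ℝ f :=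
  hf.differentiable (by simp)

lemma dirDeriv_dirDeriv_apply {k : ℕ} {f : ℝ × ℝ → Fin k → ℝ} (hf : ContDiff ℝ (⊤ : ℕ∞) f)
    (j : Fin k) :
    dirDeriv v (dirDeriv v f) w j = dirDeriv v (dirDeriv v (fun x => f x j)) w := by
  rw [dirDeriv_apply (contDiff_dirDeriv hf).differentiable_top]
  congr 1
  funext x
  exact dirDeriv_apply hf.differentiable_top j

lemma dirDeriv_dirDeriv_mul {f g : ℝ × ℝ → ℝ} (hf : ContDiff ℝ (⊤ : ℕ∞) f)
    (hg : ContDiff ℝ (⊤ : ℕ∞) g) :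
    dirDeriv v (dirDeriv v (fun x => f x * g x)) w =
      dirDeriv v (dirDeriv v f) w * g w + 2 * (dirDeriv v f w * dirDeriv v g w) +
        f w * dirDeriv v (dirDeriv v g) w := by
  have hf' := hf.differentiable_top
  have hg' := hg.differentiable_top
  have hdf := (contDiff_dirDeriv (v := v) hf).differentiable_top
  have hdg := (contDiff_dirDeriv (v := v) hg).differentiable_top
  have h : dirDeriv v (fun x => f x * g x) =
      fun x => dirDeriv v f x * g x + f x * dirDeriv v g x :=
    funext fun x => dirDeriv_mul hf' hg'
  rw [h, dirDeriv_add (hdf.fun_mul hg') (hf'.fun_mul hdg), dirDeriv_mul hdf hg', dirDeriv_mul hf' hdg]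
  ring

lemma dirDeriv_dirDeriv_add {f g : ℝ × ℝ → ℝ} (hf : ContDiff ℝ (⊤ : ℕ∞) f)
    (hg : ContDiff ℝ (⊤ : ℕ∞) g) :
    dirDeriv v (dirDeriv v (fun x => f x + g x)) w =
      dirDeriv v (dirDeriv v f) w + dirDeriv v (dirDeriv v g) w := by
  have h : dirDeriv v (fun x => f x + g x) = fun x => dirDeriv v f x + dirDeriv v g x :=
    funext fun x => dirDeriv_add hf.differentiable_top hg.differentiable_top
  rw [h, dirDeriv_add (contDiff_dirDeriv hf).differentiable_top
    (contDiff_dirDeriv hg).differentiable_top]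

lemma dirDeriv_dirDeriv_const (c : ℝ) : dirDeriv v (dirDeriv v (fun _ => c)) w = 0 := by
  have h : dirDeriv v (fun _ : ℝ × ℝ => c) = fun _ => 0 := funext fun x => dirDeriv_const c
  rw [h, dirDeriv_const]

end dirDeriv

section spaceForm

/-- The conformal factor `2 / (1 + ε|Φ|²)` of the space form of curvature `ε`. -/
def confFactor (ε : ℝ) (Φ : ℝ × ℝ → Fin 3 → ℝ) (w : ℝ × ℝ) : ℝ := 2 / (1 + ε * nsq (Φ w))

/-- The representation of `Φ` in the space form of curvature `ε`: it is `repS3` for `ε = 1` and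
`repH3` for `ε = -1`. -/
def repForm (ε : ℝ) (Φ : ℝ × ℝ → Fin 3 → ℝ) (w : ℝ × ℝ) : Fin 4 → ℝ :=
  ![confFactor ε Φ w * Φ w 0, confFactor ε Φ w * Φ w 1, confFactor ε Φ w * Φ w 2,
    ε + -ε * confFactor ε Φ w]

/-- The Gauss map of `repForm ε Φ` induced by `n`. -/
def gaussForm (ε : ℝ) (Φ n : ℝ × ℝ → Fin 3 → ℝ) (w : ℝ × ℝ) : Fin 4 → ℝ :=
  ![n w 0, n w 1, n w 2, 0] -
    (ε * confFactor ε Φ w * dot3 (n w) (Φ w)) • ![Φ w 0, Φ w 1, Φ w 2, -ε]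

/-- The ambient bilinear form of the space form of curvature `ε`. -/
def formProd (ε : ℝ) (u v : Fin 4 → ℝ) : ℝ :=
  u 0 * v 0 + u 1 * v 1 + u 2 * v 2 + ε * (u 3 * v 3)

variable {ε : ℝ} {Φ : ℝ × ℝ → Fin 3 → ℝ}

lemma confFactor_mul (hpos : ∀ w, 1 + ε * nsq (Φ w) ≠ 0) (w : ℝ × ℝ) :
    confFactor ε Φ w * (1 + ε * nsq (Φ w)) = 2 :=
  div_mul_cancel₀ _ (hpos w)

lemma contDiff_coord (hΦ : ContDiff ℝ (⊤ : ℕ∞) Φ) (j : Fin 3) :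
    ContDiff ℝ (⊤ : ℕ∞) (fun w => Φ w j) :=
  contDiff_pi.1 hΦ j

lemma contDiff_nsq (hΦ : ContDiff ℝ (⊤ : ℕ∞) Φ) :
    ContDiff ℝ (⊤ : ℕ∞) (fun w => nsq (Φ w)) :=
  (((contDiff_coord hΦ 0).pow 2).add ((contDiff_coord hΦ 1).pow 2)).add
    ((contDiff_coord hΦ 2).pow 2)

lemma contDiff_confFactor (hΦ : ContDiff ℝ (⊤ : ℕ∞) Φ) (hpos : ∀ w, 1 + ε * nsq (Φ w) ≠ 0) :
    ContDiff ℝ (⊤ : ℕ∞) (confFactor ε Φ) :=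
  contDiff_const.div (contDiff_const.add (contDiff_const.mul (contDiff_nsq hΦ))) hpos

lemma contDiff_repForm (hΦ : ContDiff ℝ (⊤ : ℕ∞) Φ) (hpos : ∀ w, 1 + ε * nsq (Φ w) ≠ 0) :
    ContDiff ℝ (⊤ : ℕ∞) (repForm ε Φ) := by
  have hq := contDiff_confFactor hΦ hpos
  refine contDiff_pi.2 fun j => ?_
  fin_cases j
  · exact hq.mul (contDiff_coord hΦ 0)
  · exact hq.mul (contDiff_coord hΦ 1)
  · exact hq.mul (contDiff_coord hΦ 2)
  · exact contDiff_const.add (contDiff_const.mul hq)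

variable {v w : ℝ × ℝ}

lemma dirDeriv_nsq (hΦ : ContDiff ℝ (⊤ : ℕ∞) Φ) :
    dirDeriv v (fun w => nsq (Φ w)) w = 2 * dot3 (Φ w) (dirDeriv v Φ w) := by
  have h0 := (contDiff_coord hΦ 0).differentiable_top
  have h1 := (contDiff_coord hΦ 1).differentiable_top
  have h2 := (contDiff_coord hΦ 2).differentiable_top
  simp only [nsq, dot3, pow_two]
  rw [dirDeriv_add ((h0.fun_mul h0).fun_add (h1.fun_mul h1)) (h2.fun_mul h2),
    dirDeriv_add (h0.fun_mul h0) (h1.fun_mul h1), dirDeriv_mul h0 h0, dirDeriv_mul h1 h1,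
    dirDeriv_mul h2 h2]
  simp only [dirDeriv_apply hΦ.differentiable_top]
  ring

lemma dirDeriv_dirDeriv_nsq (hΦ : ContDiff ℝ (⊤ : ℕ∞) Φ) :
    dirDeriv v (dirDeriv v (fun w => nsq (Φ w))) w =
      2 * (dot3 (dirDeriv v Φ w) (dirDeriv v Φ w) +
        dot3 (Φ w) (dirDeriv v (dirDeriv v Φ) w)) := by
  have h0 := contDiff_coord hΦ 0
  have h1 := contDiff_coord hΦ 1
  have h2 := contDiff_coord hΦ 2
  simp only [nsq, dot3, pow_two]
  rw [dirDeriv_dirDeriv_add ((h0.mul h0).add (h1.mul h1)) (h2.mul h2),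
    dirDeriv_dirDeriv_add (h0.mul h0) (h1.mul h1), dirDeriv_dirDeriv_mul h0 h0,
    dirDeriv_dirDeriv_mul h1 h1, dirDeriv_dirDeriv_mul h2 h2]
  simp only [dirDeriv_apply hΦ.differentiable_top, dirDeriv_dirDeriv_apply hΦ]
  ring

lemma dirDeriv_confFactor (hΦ : ContDiff ℝ (⊤ : ℕ∞) Φ) (hpos : ∀ w, 1 + ε * nsq (Φ w) ≠ 0) :
    dirDeriv v (confFactor ε Φ) w =
      -ε * confFactor ε Φ w ^ 2 * dot3 (Φ w) (dirDeriv v Φ w) := by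
  have hq := (contDiff_confFactor hΦ hpos).differentiable_top
  have hr := (contDiff_nsq hΦ).differentiable_top
  have hc : ∀ c : ℝ, Differentiable ℝ (fun _ : ℝ × ℝ => c) := differentiable_const
  have h : dirDeriv v (fun x => confFactor ε Φ x * (1 + ε * nsq (Φ x))) w = 0 := by
    rw [funext (confFactor_mul hpos), dirDeriv_const]
  rw [dirDeriv_mul hq ((hc 1).fun_add ((hc ε).fun_mul hr)),
    dirDeriv_add (hc 1) ((hc ε).fun_mul hr), dirDeriv_mul (hc ε) hr, dirDeriv_const, dirDeriv_const, dirDeriv_nsq hΦ] at h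
  linear_combination confFactor ε Φ w / 2 * h -
    dirDeriv v (confFactor ε Φ) w / 2 * confFactor_mul hpos w

lemma dirDeriv_dirDeriv_confFactor (hΦ : ContDiff ℝ (⊤ : ℕ∞) Φ)
    (hpos : ∀ w, 1 + ε * nsq (Φ w) ≠ 0) :
    dirDeriv v (dirDeriv v (confFactor ε Φ)) w =
      2 * ε ^ 2 * confFactor ε Φ w ^ 3 * dot3 (Φ w) (dirDeriv v Φ w) ^ 2 -
        ε * confFactor ε Φ w ^ 2 * (dot3 (dirDeriv v Φ w) (dirDeriv v Φ w) +
          dot3 (Φ w) (dirDeriv v (dirDeriv v Φ) w)) := by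
  have hq := contDiff_confFactor hΦ hpos
  have hr := contDiff_nsq hΦ
  have hc : ∀ c : ℝ, ContDiff ℝ (⊤ : ℕ∞) (fun _ : ℝ × ℝ => c) := fun _ => contDiff_const
  have h : dirDeriv v (dirDeriv v (fun x => confFactor ε Φ x * (1 + ε * nsq (Φ x)))) w = 0 := by
    rw [funext (confFactor_mul hpos), dirDeriv_dirDeriv_const]
  rw [dirDeriv_dirDeriv_mul hq ((hc 1).add ((hc ε).mul hr)),
    dirDeriv_dirDeriv_add (hc 1) ((hc ε).mul hr), dirDeriv_dirDeriv_mul (hc ε) hr,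
    dirDeriv_dirDeriv_const, dirDeriv_dirDeriv_const,
    dirDeriv_add (hc 1).differentiable_top ((hc ε).mul hr).differentiable_top,
    dirDeriv_mul (hc ε).differentiable_top hr.differentiable_top, dirDeriv_const, dirDeriv_const,
    dirDeriv_nsq hΦ, dirDeriv_dirDeriv_nsq hΦ, dirDeriv_confFactor hΦ hpos] at h
  linear_combination confFactor ε Φ w / 2 * h -
    dirDeriv v (dirDeriv v (confFactor ε Φ)) w / 2 * confFactor_mul hpos w

/-- The representation in a space form is conformal to `Φ`. -/
lemma formProd_dirDeriv_repForm (hε : ε ^ 2 = 1) (hΦ : ContDiff ℝ (⊤ : ℕ∞) Φ)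
    (hpos : ∀ w, 1 + ε * nsq (Φ w) ≠ 0) :
    formProd ε (dirDeriv v (repForm ε Φ) w) (dirDeriv v (repForm ε Φ) w) =
      confFactor ε Φ w ^ 2 * dot3 (dirDeriv v Φ w) (dirDeriv v Φ w) := by
  have hq := (contDiff_confFactor hΦ hpos).differentiable_top
  have hj := fun j => (contDiff_coord hΦ j).differentiable_top
  have hc : ∀ c : ℝ, Differentiable ℝ (fun _ : ℝ × ℝ => c) := differentiable_const
  have hF : ∀ j : Fin 3, dirDeriv v (fun x => confFactor ε Φ x * Φ x j) w =
      -ε * confFactor ε Φ w ^ 2 * dot3 (Φ w) (dirDeriv v Φ w) * Φ w j +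
        confFactor ε Φ w * dirDeriv v Φ w j := fun j => by
    rw [dirDeriv_mul hq (hj j), dirDeriv_confFactor hΦ hpos, dirDeriv_apply hΦ.differentiable_top]
  have hF3 : dirDeriv v (fun x => ε + -ε * confFactor ε Φ x) w =
      confFactor ε Φ w ^ 2 * dot3 (Φ w) (dirDeriv v Φ w) := by
    rw [dirDeriv_add (hc ε) ((hc (-ε)).fun_mul hq), dirDeriv_mul (hc (-ε)) hq, dirDeriv_const,
      dirDeriv_const, dirDeriv_confFactor hΦ hpos]
    linear_combination confFactor ε Φ w ^ 2 * dot3 (Φ w) (dirDeriv v Φ w) * hε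
  have hq2 := confFactor_mul hpos w
  simp only [formProd, dirDeriv_apply (contDiff_repForm hΦ hpos).differentiable_top]
  change dirDeriv v (fun x => confFactor ε Φ x * Φ x 0) w *
      dirDeriv v (fun x => confFactor ε Φ x * Φ x 0) w +
      dirDeriv v (fun x => confFactor ε Φ x * Φ x 1) w *
      dirDeriv v (fun x => confFactor ε Φ x * Φ x 1) w +
      dirDeriv v (fun x => confFactor ε Φ x * Φ x 2) w *
      dirDeriv v (fun x => confFactor ε Φ x * Φ x 2) w +
      ε * (dirDeriv v (fun x => ε + -ε * confFactor ε Φ x) w *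
      dirDeriv v (fun x => ε + -ε * confFactor ε Φ x) w) = _
  rw [hF, hF, hF, hF3]
  have hdot : dot3 (Φ w) (dirDeriv v Φ w) = Φ w 0 * dirDeriv v Φ w 0 +
    Φ w 1 * dirDeriv v Φ w 1 + Φ w 2 * dirDeriv v Φ w 2 := rfl
  have hdd : dot3 (dirDeriv v Φ w) (dirDeriv v Φ w) = dirDeriv v Φ w 0 * dirDeriv v Φ w 0 +
    dirDeriv v Φ w 1 * dirDeriv v Φ w 1 + dirDeriv v Φ w 2 * dirDeriv v Φ w 2 := rfl
  simp only [nsq] at hq2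
  rw [hdd]
  generalize dot3 (Φ w) (dirDeriv v Φ w) = ρ at *
  generalize confFactor ε Φ w = q at *
  linear_combination ε * q ^ 3 * ρ ^ 2 * hq2 + 2 * ε * q ^ 3 * ρ * hdot

/-- The normal component of the second derivatives of the representation in a space form. -/
lemma formProd_dirDeriv_dirDeriv_repForm {n : ℝ × ℝ → Fin 3 → ℝ} (hε : ε ^ 2 = 1)
    (hΦ : ContDiff ℝ (⊤ : ℕ∞) Φ) (hpos : ∀ w, 1 + ε * nsq (Φ w) ≠ 0)
    (hn : dot3 (n w) (dirDeriv v Φ w) = 0) :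
    formProd ε (dirDeriv v (dirDeriv v (repForm ε Φ)) w) (gaussForm ε Φ n w) =
      confFactor ε Φ w * dot3 (dirDeriv v (dirDeriv v Φ) w) (n w) +
        ε * confFactor ε Φ w ^ 2 * dot3 (n w) (Φ w) *
          dot3 (dirDeriv v Φ w) (dirDeriv v Φ w) := by
  have hq := contDiff_confFactor hΦ hpos
  have hj := fun j => contDiff_coord hΦ j
  have hc : ∀ c : ℝ, ContDiff ℝ (⊤ : ℕ∞) (fun _ : ℝ × ℝ => c) := fun _ => contDiff_const
  have hF : ∀ j : Fin 3, dirDeriv v (dirDeriv v (fun x => confFactor ε Φ x * Φ x j)) w =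
      dirDeriv v (dirDeriv v (confFactor ε Φ)) w * Φ w j +
        2 * (-ε * confFactor ε Φ w ^ 2 * dot3 (Φ w) (dirDeriv v Φ w) * dirDeriv v Φ w j) +
        confFactor ε Φ w * dirDeriv v (dirDeriv v Φ) w j := fun j => by
    rw [dirDeriv_dirDeriv_mul hq (hj j), dirDeriv_confFactor hΦ hpos,
      dirDeriv_apply hΦ.differentiable_top, dirDeriv_dirDeriv_apply hΦ]
  have hF3 : dirDeriv v (dirDeriv v (fun x => ε + -ε * confFactor ε Φ x)) w =
      -ε * dirDeriv v (dirDeriv v (confFactor ε Φ)) w := by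
    rw [dirDeriv_dirDeriv_add (hc ε) ((hc (-ε)).mul hq), dirDeriv_dirDeriv_mul (hc (-ε)) hq,
      dirDeriv_dirDeriv_const, dirDeriv_dirDeriv_const, dirDeriv_const]
    ring
  have hq2 := confFactor_mul hpos w
  have hqq := dirDeriv_dirDeriv_confFactor (v := v) (w := w) hΦ hpos
  simp only [formProd, dirDeriv_dirDeriv_apply (contDiff_repForm hΦ hpos)]
  change dirDeriv v (dirDeriv v (fun x => confFactor ε Φ x * Φ x 0)) w * gaussForm ε Φ n w 0 +
      dirDeriv v (dirDeriv v (fun x => confFactor ε Φ x * Φ x 1)) w * gaussForm ε Φ n w 1 +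
      dirDeriv v (dirDeriv v (fun x => confFactor ε Φ x * Φ x 2)) w * gaussForm ε Φ n w 2 +
      ε * (dirDeriv v (dirDeriv v (fun x => ε + -ε * confFactor ε Φ x)) w *
        gaussForm ε Φ n w 3) = _
  have hg : ∀ j : Fin 3, gaussForm ε Φ n w j.castSucc =
      n w j - ε * confFactor ε Φ w * dot3 (n w) (Φ w) * Φ w j := fun j => by
    fin_cases j <;> simp [gaussForm]
  have hg3 : gaussForm ε Φ n w 3 = confFactor ε Φ w * dot3 (n w) (Φ w) := by
    simp [gaussForm]
    linear_combination confFactor ε Φ w * dot3 (n w) (Φ w) * hε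
  rw [hF, hF, hF, hF3, show gaussForm ε Φ n w 0 = _ from hg 0,
    show gaussForm ε Φ n w 1 = _ from hg 1, show gaussForm ε Φ n w 2 = _ from hg 2, hg3]
  generalize dirDeriv v (dirDeriv v (confFactor ε Φ)) w = Q at *
  generalize confFactor ε Φ w = q at *
  generalize dirDeriv v (dirDeriv v Φ) w = b at *
  generalize dirDeriv v Φ w = a at *
  generalize hP : dot3 (n w) (Φ w) = P at *
  generalize hR : dot3 (Φ w) a = ρ at *
  generalize hS : dot3 (Φ w) b = σ at *
  generalize hA : dot3 a a = A at *
  simp only [nsq] at hq2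
  simp only [dot3] at hP hR hS hn ⊢
  linear_combination Q * hP - Q * P * hq2 + (-2 * ε * q ^ 2 * ρ) * hn - P * hqq +
    2 * ε ^ 2 * q ^ 3 * P * ρ * hR - ε * q ^ 2 * P * hS - Q * P * q * hε

/-- The mean curvature in a space form in terms of the mean curvature in `ℝ³`. -/
lemma meanCurvature_repForm {n : ℝ × ℝ → Fin 3 → ℝ} (hε : ε ^ 2 = 1)
    (hΦ : ContDiff ℝ (⊤ : ℕ∞) Φ) (hpos : ∀ w, 1 + ε * nsq (Φ w) ≠ 0)
    (hconf : dot3 (d1 Φ w) (d1 Φ w) = dot3 (d2 Φ w) (d2 Φ w))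
    (himm : dot3 (d1 Φ w) (d1 Φ w) ≠ 0)
    (hn1 : dot3 (n w) (d1 Φ w) = 0) (hn2 : dot3 (n w) (d2 Φ w) = 0) :
    formProd ε (lap (repForm ε Φ) w) (gaussForm ε Φ n w) /
        (2 * formProd ε (d1 (repForm ε Φ) w) (d1 (repForm ε Φ) w)) =
      meanH Φ n w * ((1 + ε * nsq (Φ w)) / 2) + ε * dot3 (n w) (Φ w) := by
  have e1 : formProd ε (d1 (d1 (repForm ε Φ)) w) (gaussForm ε Φ n w) =
      confFactor ε Φ w * dot3 (d1 (d1 Φ) w) (n w) +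
        ε * confFactor ε Φ w ^ 2 * dot3 (n w) (Φ w) * dot3 (d1 Φ w) (d1 Φ w) :=
    formProd_dirDeriv_dirDeriv_repForm hε hΦ hpos hn1
  have e2 : formProd ε (d2 (d2 (repForm ε Φ)) w) (gaussForm ε Φ n w) =
      confFactor ε Φ w * dot3 (d2 (d2 Φ) w) (n w) +
        ε * confFactor ε Φ w ^ 2 * dot3 (n w) (Φ w) * dot3 (d2 Φ w) (d2 Φ w) :=
    formProd_dirDeriv_dirDeriv_repForm hε hΦ hpos hn2
  have e3 : formProd ε (d1 (repForm ε Φ) w) (d1 (repForm ε Φ) w) =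
      confFactor ε Φ w ^ 2 * dot3 (d1 Φ w) (d1 Φ w) := formProd_dirDeriv_repForm hε hΦ hpos
  have hl : formProd ε (lap (repForm ε Φ) w) (gaussForm ε Φ n w) =
      formProd ε (d1 (d1 (repForm ε Φ)) w) (gaussForm ε Φ n w) +
        formProd ε (d2 (d2 (repForm ε Φ)) w) (gaussForm ε Φ n w) := by
    simp only [lap, formProd, Pi.add_apply]
    ring
  have hl' : dot3 (lap Φ w) (n w) = dot3 (d1 (d1 Φ) w) (n w) + dot3 (d2 (d2 Φ) w) (n w) := by
    simp only [lap, dot3, Pi.add_apply]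
    ring
  have hp := hpos w
  rw [hl, e1, e2, e3, meanH, hl', ← hconf, confFactor]
  field_simp
  ring

lemma repS3_eq_repForm (Φ : ℝ × ℝ → Fin 3 → ℝ) : repS3 Φ = repForm 1 Φ := by
  funext w j
  have h : 1 + nsq (Φ w) ≠ 0 := by unfold nsq; positivity
  fin_cases j <;> simp [repS3, repForm, confFactor] <;> field_simp
  ring

lemma gaussS3_eq_gaussForm (Φ n : ℝ × ℝ → Fin 3 → ℝ) : gaussS3 Φ n = gaussForm 1 Φ n := by
  funext w
  simp only [gaussS3, gaussForm, confFactor]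
  congr 2
  ring

lemma repH3_eq_repForm (hball : ∀ w, nsq (Φ w) < 1) : repH3 Φ = repForm (-1) Φ := by
  funext w j
  have h : 1 - nsq (Φ w) ≠ 0 := by linarith [hball w]
  fin_cases j <;> simp [repH3, repForm, confFactor, ← sub_eq_add_neg] <;> field_simp
  ring

lemma gaussH3_eq_gaussForm (Φ n : ℝ × ℝ → Fin 3 → ℝ) : gaussH3 Φ n = gaussForm (-1) Φ n := by
  funext w
  simp only [gaussH3, gaussForm, confFactor, neg_neg, sub_eq_add_neg, ← neg_smul]
  congr 2
  ring

lemma dot4_eq_formProd (u v : Fin 4 → ℝ) : dot4 u v = formProd 1 u v := by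
  simp [dot4, formProd]

lemma L31_eq_formProd (u v : Fin 4 → ℝ) : L31 u v = formProd (-1) u v := by
  simp [L31, formProd, sub_eq_add_neg]

end spaceForm

/-- The mean curvatures of `Φ`, of its representation `X` in `S³` and of its
representation `Z` in `ℍ³` can be read on the conformal Gauss map:
`H = Y₅ − Y₄`, `h = Y₅` and `H^Z = −Y₄`. -/
theorem stmt14 (Φ n : ℝ × ℝ → Fin 3 → ℝ)
    (hΦ : ContDiff ℝ (⊤ : ℕ∞) Φ) (hn : ContDiff ℝ (⊤ : ℕ∞) n)
    (hconf : ∀ w, dot3 (d1 Φ w) (d1 Φ w) = dot3 (d2 Φ w) (d2 Φ w) ∧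
      dot3 (d1 Φ w) (d2 Φ w) = 0)
    (himm : ∀ w, dot3 (d1 Φ w) (d1 Φ w) ≠ 0)
    (hnunit : ∀ w, dot3 (n w) (n w) = 1)
    (hn1 : ∀ w, dot3 (n w) (d1 Φ w) = 0)
    (hn2 : ∀ w, dot3 (n w) (d2 Φ w) = 0)
    (hball : ∀ w, nsq (Φ w) < 1) :
    ∀ w, meanH Φ n w = confGauss Φ n w 4 - confGauss Φ n w 3 ∧
      meanS3 Φ n w = confGauss Φ n w 4 ∧
      meanH3 Φ n w = -(confGauss Φ n w 3) := by
  intro w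
  have hS : ∀ w, 1 + 1 * nsq (Φ w) ≠ 0 := fun w => by unfold nsq; positivity
  have hH : ∀ w, 1 + -1 * nsq (Φ w) ≠ 0 := fun w => by linarith [hball w]
  have h3 : confGauss Φ n w 3 =
      meanH Φ n w * ((nsq (Φ w) - 1) / 2) + dot3 (n w) (Φ w) := by
    simp [confGauss, pmap]
  have h4 : confGauss Φ n w 4 =
      meanH Φ n w * ((nsq (Φ w) + 1) / 2) + dot3 (n w) (Φ w) := by
    simp [confGauss, pmap]
  refine ⟨?_, ?_, ?_⟩
  · rw [h3, h4]
    ring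
  · rw [h4, meanS3, repS3_eq_repForm, gaussS3_eq_gaussForm, dot4_eq_formProd, dot4_eq_formProd,
      meanCurvature_repForm (by norm_num) hΦ hS (hconf w).1 (himm w) (hn1 w) (hn2 w)]
    ring
  · rw [h3, meanH3, repH3_eq_repForm hball, gaussH3_eq_gaussForm, L31_eq_formProd,
      L31_eq_formProd,
      meanCurvature_repForm (by norm_num) hΦ hH (hconf w).1 (himm w) (hn1 w) (hn2 w)]
    ring
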